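/- Consider the AUQ-ADMM iterates with convex functions f_j : ℝⁿ → ℝ (j = 1,…,N) and g : ℝⁿ → ℝ, with weight vectors w_j⁽ᵏ⁾ whose entries lie in the restriction intervals [a_k, b_k] (and w_j⁽⁰⁾ = w_j⁽¹⁾), and assume a saddle point y* = (u*, v*, λ*) of the consensus Lagrangian exists. Then the successive iterates y⁽ᵏ⁾ = (u⁽ᵏ⁾, v⁽ᵏ⁾, λ⁽ᵏ⁾) satisfy lim_{k→∞} ‖y⁽ᵏ⁺¹⁾ − y⁽ᵏ⁾‖²_{T⁽ᵏ⁾} = 0, i.e., ∑_{j=1}^N ‖v⁽ᵏ⁺¹⁾ − v⁽ᵏ⁾‖²_{w_j⁽ᵏ⁾} + ∑_{j=1}^N ‖λ_j⁽ᵏ⁺¹⁾ − λ_j⁽ᵏ⁾‖²_{1/w_j⁽ᵏ⁾} → 0 as k → ∞. -/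

import Mathlib

/-- Upper endpoint of the restriction interval at step `k`:
`b_k = a₁ * ((1/k²)·(b₁/a₁) + 1 − 1/k²)`. -/
noncomputable def bEnd (a₁ b₁ : ℝ) (k : ℕ) : ℝ :=
  a₁ * ((1 / (k : ℝ) ^ 2) * (b₁ / a₁) + 1 - 1 / (k : ℝ) ^ 2)

/-- Weighted squared norm `‖x‖²_w = ∑ᵢ wᵢ·xᵢ²`. -/
noncomputable def wnormSq {n : ℕ} (w x : Fin n → ℝ) : ℝ := ∑ i, w i * x i ^ 2

/-- `T`-seminorm (squared) of a triple `y = (u, v, λ)` determined by the weights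
`w_j`: `‖y‖²_T = ∑_j ‖v‖²_{w_j} + ∑_j ‖λ_j‖²_{1/w_j}`. -/
noncomputable def TnormSq {n N : ℕ} (w : Fin N → Fin n → ℝ)
    (v : Fin n → ℝ) (lam : Fin N → Fin n → ℝ) : ℝ :=
  (∑ j, wnormSq (w j) v) + ∑ j, wnormSq (fun i => 1 / w j i) (lam j)

open Filter Topology Finset

lemma nonneg_of_forall_nonneg_add_mul {A Q : ℝ}
    (h : ∀ t : ℝ, 0 < t → t ≤ 1 → 0 ≤ A + t * Q) : 0 ≤ A := by
  have hlim : Tendsto (fun t : ℝ => A + t * Q) (𝓝[>] 0) (𝓝 A) := by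
    have : Tendsto (fun t : ℝ => A + t * Q) (𝓝 0) (𝓝 (A + 0 * Q)) :=
      Continuous.tendsto (by fun_prop) 0
    simpa using this.mono_left nhdsWithin_le_nhds
  refine ge_of_tendsto hlim ?_
  filter_upwards [Ioc_mem_nhdsGT (zero_lt_one' ℝ)] with t ht
  exact h t ht.1 ht.2

/-- First-order optimality for a convex function plus weighted squared distances. -/
lemma ConvexOn.le_add_sum_of_isMin {ι : Type*} [Fintype ι] {n : ℕ} {f : (Fin n → ℝ) → ℝ}
    (hf : ConvexOn ℝ Set.univ f) (w c : ι → Fin n → ℝ) (x : Fin n → ℝ)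
    (hx : ∀ z, f x + (1 / 2) * ∑ j, wnormSq (w j) (x - c j) ≤
      f z + (1 / 2) * ∑ j, wnormSq (w j) (z - c j)) (z : Fin n → ℝ) :
    f x ≤ f z + ∑ j, ∑ i, w j i * (x i - c j i) * (z i - x i) := by
  suffices 0 ≤ f z - f x + ∑ j, ∑ i, w j i * (x i - c j i) * (z i - x i) by linarith
  refine nonneg_of_forall_nonneg_add_mul
    (Q := (1 / 2) * ∑ j, ∑ i, w j i * (z i - x i) ^ 2) fun t ht ht1 => ?_
  have hmin := hx ((1 - t) • x + t • z)
  have hconv := hf.2 (Set.mem_univ x) (Set.mem_univ z) (sub_nonneg.2 ht1) ht.le (by ring)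
  have hquad : ∑ j, wnormSq (w j) ((1 - t) • x + t • z - c j) =
      ∑ j, wnormSq (w j) (x - c j) +
        2 * t * ∑ j, ∑ i, w j i * (x i - c j i) * (z i - x i) +
        t ^ 2 * ∑ j, ∑ i, w j i * (z i - x i) ^ 2 := by
    simp only [wnormSq, mul_sum, ← sum_add_distrib]
    refine sum_congr rfl fun j _ => sum_congr rfl fun i _ => ?_
    simp only [Pi.add_apply, Pi.sub_apply, Pi.smul_apply, smul_eq_mul]
    ring
  rw [hquad] at hmin
  simp only [smul_eq_mul] at hconv
  refine nonneg_of_mul_nonneg_right ?_ ht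
  linarith

lemma TnormSq_eq_sum {n N : ℕ} (w : Fin N → Fin n → ℝ) (v : Fin n → ℝ)
    (lam : Fin N → Fin n → ℝ) :
    TnormSq w v lam = ∑ j, ∑ i, (w j i * v i ^ 2 + 1 / w j i * lam j i ^ 2) := by
  simp only [TnormSq, wnormSq, sum_add_distrib]

lemma TnormSq_nonneg {n N : ℕ} {w : Fin N → Fin n → ℝ} (hw : ∀ j i, 0 < w j i)
    (v : Fin n → ℝ) (lam : Fin N → Fin n → ℝ) : 0 ≤ TnormSq w v lam := by
  rw [TnormSq_eq_sum]
  refine sum_nonneg fun j _ => sum_nonneg fun i _ => ?_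
  have := hw j i
  positivity

lemma TnormSq_le_mul {n N : ℕ} {w w' : Fin N → Fin n → ℝ} {r : ℝ}
    (h : ∀ j i, w' j i ≤ r * w j i) (h' : ∀ j i, 1 / w' j i ≤ r * (1 / w j i))
    (v : Fin n → ℝ) (lam : Fin N → Fin n → ℝ) :
    TnormSq w' v lam ≤ r * TnormSq w v lam := by
  simp only [TnormSq_eq_sum, mul_sum]
  refine sum_le_sum fun j _ => sum_le_sum fun i _ => ?_
  rw [mul_add, ← mul_assoc, ← mul_assoc]
  gcongr
  exacts [h j i, h' j i]

lemma bEnd_eq (a₁ b₁ : ℝ) (k : ℕ) :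
    bEnd a₁ b₁ k = (1 + (b₁ / a₁ - 1) * (1 / (k : ℝ) ^ 2)) * a₁ := by
  rw [bEnd]
  ring

lemma bEnd_succ_le {a₁ b₁ : ℝ} (ha : 0 < a₁) (hab : a₁ ≤ b₁) {k : ℕ} (hk : 1 ≤ k) :
    bEnd a₁ b₁ (k + 1) ≤ bEnd a₁ b₁ k := by
  have hk' : (0 : ℝ) < k := by exact_mod_cast hk
  have hC : 0 ≤ b₁ / a₁ - 1 := by rw [sub_nonneg, one_le_div ha]; exact hab
  rw [bEnd_eq, bEnd_eq]
  push_cast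
  gcongr
  linarith

/-- A perturbed Fejér monotone sequence has vanishing decrements. -/
lemma tendsto_zero_of_perturbed_descent {V U D c : ℕ → ℝ} (hV : ∀ k, 0 ≤ V k)
    (hU : ∀ k, 0 ≤ U k) (hD : ∀ k, 0 ≤ D k) (hc : ∀ k, 0 ≤ c k) (hsum : Summable c)
    (hdesc : ∀ k, U k + D k ≤ V k) (hpert : ∀ k, V (k + 1) ≤ (1 + c k) * U k) :
    Tendsto D atTop (𝓝 0) := by
  set S : ℕ → ℝ := fun k => ∑ i ∈ range k, c i with hS
  set W : ℕ → ℝ := fun k => Real.exp (-S k) * V k with hW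
  have hstep (k : ℕ) : Real.exp (-S k) * D k ≤ W k - W (k + 1) := by
    have h1 : W (k + 1) ≤ Real.exp (-S k) * U k := by
      calc W (k + 1) ≤ Real.exp (-S (k + 1)) * (Real.exp (c k) * U k) := by
            have hexp : 1 + c k ≤ Real.exp (c k) := by
              linarith [Real.add_one_le_exp (c k)]
            exact mul_le_mul_of_nonneg_left
              ((hpert k).trans (mul_le_mul_of_nonneg_right hexp (hU k))) (Real.exp_pos _).le
        _ = Real.exp (-S k) * U k := by
            rw [← mul_assoc, ← Real.exp_add, hS]
            simp only [sum_range_succ]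
            ring_nf
    have h2 := mul_le_mul_of_nonneg_left (hdesc k) (Real.exp_pos (-S k)).le
    rw [mul_add] at h2
    simp only [hW] at h1 ⊢
    linarith
  have hanti : Antitone W := antitone_nat_of_succ_le fun k => by
    have := mul_nonneg (Real.exp_pos (-S k)).le (hD k)
    linarith [hstep k]
  have hbdd : BddBelow (Set.range W) :=
    ⟨0, by rintro _ ⟨k, rfl⟩; exact mul_nonneg (Real.exp_pos _).le (hV k)⟩
  have hlim := tendsto_atTop_ciInf hanti hbdd
  have hdiff : Tendsto (fun k => W k - W (k + 1)) atTop (𝓝 0) := by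
    simpa using hlim.sub ((tendsto_add_atTop_iff_nat 1).2 hlim)
  refine squeeze_zero hD (fun k => ?_)
    (by simpa using hdiff.const_mul (Real.exp (∑' i, c i)))
  calc D k = Real.exp (S k) * (Real.exp (-S k) * D k) := by
        rw [← mul_assoc, ← Real.exp_add]; simp
    _ ≤ Real.exp (∑' i, c i) * (W k - W (k + 1)) := by
        refine mul_le_mul ?_ (hstep k) (mul_nonneg (Real.exp_pos _).le (hD k))
          (Real.exp_pos _).le
        exact Real.exp_le_exp.2 (hsum.sum_le_tsum _ fun i _ => hc i)

/-- One ADMM step from `(v, lam)` to `(u', v', lam')` decreases the weighted distance to a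
saddle point, given the first-order optimality conditions and monotonicity in `v`. -/
lemma TnormSq_descent {n N : ℕ} {f : Fin N → (Fin n → ℝ) → ℝ} {g : (Fin n → ℝ) → ℝ}
    {w : Fin N → Fin n → ℝ} (hw : ∀ j i, 0 < w j i)
    {v v' vstar : Fin n → ℝ} {u' lam lam' lamstar : Fin N → Fin n → ℝ}
    (hlam : ∀ j i, lam' j i = lam j i + w j i * (v' i - u' j i))
    (hF : ∀ j, f j (u' j) ≤
      f j vstar + ∑ i, (lam' j i - w j i * (v' i - v i)) * (u' j i - vstar i))
    (hG : g v' ≤ g vstar + ∑ j, ∑ i, lam' j i * (vstar i - v' i))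
    (hmono : ∑ j, ∑ i, (lam' j i - lam j i) * (v' i - v i) ≤ 0)
    (hsaddle : (∑ j, f j vstar) + g vstar ≤
      (∑ j, f j (u' j)) + g v' + ∑ j, ∑ i, lamstar j i * (v' i - u' j i)) :
    TnormSq w (v' - vstar) (lam' - lamstar) + TnormSq w (v' - v) (lam' - lam) ≤
      TnormSq w (v - vstar) (lam - lamstar) := by
  have hFsum := sum_le_sum fun j (_ : j ∈ univ) => hF j
  rw [sum_add_distrib] at hFsum
  have hid : TnormSq w (v' - vstar) (lam' - lamstar) + TnormSq w (v' - v) (lam' - lam) =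
      TnormSq w (v - vstar) (lam - lamstar) +
        2 * (∑ j, ∑ i, (lam' j i - lam j i) * (v' i - v i) -
          ∑ j, ∑ i, (lam' j i - w j i * (v' i - v i)) * (u' j i - vstar i) -
          ∑ j, ∑ i, lam' j i * (vstar i - v' i) -
          ∑ j, ∑ i, lamstar j i * (v' i - u' j i)) := by
    simp only [TnormSq_eq_sum, mul_sum, ← sum_add_distrib, ← sum_sub_distrib]
    refine sum_congr rfl fun j _ => sum_congr rfl fun i _ => ?_
    have := (hw j i).ne'
    simp only [Pi.sub_apply, hlam]
    field_simp
    ring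
  linarith

/-- for the AUQ-ADMM iterates with convex objectives, weight vectors
lying in the restriction intervals and a saddle point of the consensus Lagrangian,
the successive iterates satisfy `‖y⁽ᵏ⁺¹⁾ − y⁽ᵏ⁾‖²_{T⁽ᵏ⁾} → 0`. -/
theorem stmt9 (a₁ b₁ : ℝ) (ha : 0 < a₁) (hab : a₁ ≤ b₁)
    (n N : ℕ) (hn : 1 ≤ n) (hN : 1 ≤ N)
    (f : Fin N → (Fin n → ℝ) → ℝ) (g : (Fin n → ℝ) → ℝ)
    (hf : ∀ j, ConvexOn ℝ Set.univ (f j)) (hg : ConvexOn ℝ Set.univ g)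
    (w : ℕ → Fin N → Fin n → ℝ)
    (hw : ∀ k : ℕ, 1 ≤ k → ∀ j i, w k j i ∈ Set.Icc a₁ (bEnd a₁ b₁ k))
    (hw0 : w 0 = w 1)
    (u : ℕ → Fin N → Fin n → ℝ) (v : ℕ → Fin n → ℝ) (lam : ℕ → Fin N → Fin n → ℝ)
    -- u-update: `u_j⁽ᵏ⁺¹⁾` globally minimizes `f_j(u) + ½‖v⁽ᵏ⁾ − u + λ_j⁽ᵏ⁾/w_j⁽ᵏ⁾‖²_{w_j⁽ᵏ⁾}`
    (hu : ∀ (k : ℕ) (j : Fin N) (x : Fin n → ℝ),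
      f j (u (k + 1) j) +
        (1 / 2) * wnormSq (w k j) (v k - u (k + 1) j + fun i => lam k j i / w k j i) ≤
      f j x + (1 / 2) * wnormSq (w k j) (v k - x + fun i => lam k j i / w k j i))
    -- v-update: `v⁽ᵏ⁺¹⁾` globally minimizes `g(v) + ½∑_j ‖v − u_j⁽ᵏ⁺¹⁾ + λ_j⁽ᵏ⁾/w_j⁽ᵏ⁾‖²_{w_j⁽ᵏ⁾}`
    (hv : ∀ (k : ℕ) (z : Fin n → ℝ),
      g (v (k + 1)) +
        (1 / 2) * ∑ j, wnormSq (w k j)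
          (v (k + 1) - u (k + 1) j + fun i => lam k j i / w k j i) ≤
      g z + (1 / 2) * ∑ j, wnormSq (w k j)
          (z - u (k + 1) j + fun i => lam k j i / w k j i))
    -- dual update: `λ_j⁽ᵏ⁺¹⁾ = λ_j⁽ᵏ⁾ + w_j⁽ᵏ⁾ ⊙ (v⁽ᵏ⁺¹⁾ − u_j⁽ᵏ⁺¹⁾)`
    (hlam : ∀ (k : ℕ) (j : Fin N),
      lam (k + 1) j = lam k j + fun i => w k j i * (v (k + 1) i - u (k + 1) j i))
    -- saddle point
    (ustar : Fin N → Fin n → ℝ) (vstar : Fin n → ℝ) (lamstar : Fin N → Fin n → ℝ)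
    (hcons : ∀ j, ustar j = vstar)
    (hsaddle : ∀ (uu : Fin N → Fin n → ℝ) (z : Fin n → ℝ),
      (∑ j, f j (ustar j)) + g vstar ≤
        (∑ j, f j (uu j)) + g z + ∑ j, ∑ i, lamstar j i * (z i - uu j i)) :
    Filter.Tendsto
      (fun k : ℕ =>
        TnormSq (w k) (v (k + 1) - v k) (fun j => lam (k + 1) j - lam k j))
      Filter.atTop (nhds 0) := by
  have hpos (k : ℕ) (j : Fin N) (i : Fin n) : 0 < w k j i := by
    rcases Nat.eq_zero_or_pos k with rfl | hk
    · rw [hw0]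
      exact ha.trans_le (hw 1 le_rfl j i).1
    · exact ha.trans_le (hw k hk j i).1
  have hlam' (k : ℕ) (j : Fin N) (i : Fin n) :
      lam (k + 1) j i = lam k j i + w k j i * (v (k + 1) i - u (k + 1) j i) := by
    rw [hlam k j]
    rfl
  have hG (k : ℕ) (z : Fin n → ℝ) :
      g (v (k + 1)) ≤ g z + ∑ j, ∑ i, lam (k + 1) j i * (z i - v (k + 1) i) := by
    have h := hg.le_add_sum_of_isMin (w k)
      (fun j => u (k + 1) j - fun i => lam k j i / w k j i) (v (k + 1))
      (fun z => by simpa only [sub_sub_eq_add_sub, sub_add_eq_add_sub] using hv k z) z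
    refine h.trans_eq (congrArg (g z + ·) ?_)
    refine sum_congr rfl fun j _ => sum_congr rfl fun i _ => ?_
    have := (hpos k j i).ne'
    simp only [Pi.sub_apply, hlam']
    field_simp
    ring
  have hF (k : ℕ) (j : Fin N) (z : Fin n → ℝ) :
      f j (u (k + 1) j) ≤ f j z + ∑ i, (lam (k + 1) j i -
        w k j i * (v (k + 1) i - v k i)) * (u (k + 1) j i - z i) := by
    have hsymm (x : Fin n → ℝ) :
        wnormSq (w k j) (x - (v k + fun i => lam k j i / w k j i)) =
          wnormSq (w k j) (v k - x + fun i => lam k j i / w k j i) := by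
      refine sum_congr rfl fun i _ => ?_
      simp only [Pi.sub_apply, Pi.add_apply]
      ring
    have h := (hf j).le_add_sum_of_isMin (fun _ : Unit => w k j)
      (fun _ => v k + fun i => lam k j i / w k j i) (u (k + 1) j)
      (fun x => by simpa [hsymm] using hu k j x) z
    refine h.trans_eq (congrArg (f j z + ·) ?_)
    rw [univ_unique, sum_singleton]
    refine sum_congr rfl fun i _ => ?_
    have := (hpos k j i).ne'
    simp only [Pi.add_apply, hlam']
    field_simp
    ring
  have hmono (k : ℕ) :
      ∑ j, ∑ i, (lam (k + 2) j i - lam (k + 1) j i) * (v (k + 2) i - v (k + 1) i) ≤ 0 := by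
    have h1 := hG k (v (k + 2))
    have h2 := hG (k + 1) (v (k + 1))
    have hid : ∑ j, ∑ i, (lam (k + 2) j i - lam (k + 1) j i) * (v (k + 2) i - v (k + 1) i) =
        -(∑ j, ∑ i, lam (k + 1) j i * (v (k + 2) i - v (k + 1) i)) -
          ∑ j, ∑ i, lam (k + 2) j i * (v (k + 1) i - v (k + 2) i) := by
      simp only [← sum_neg_distrib, ← sum_sub_distrib]
      exact sum_congr rfl fun j _ => sum_congr rfl fun i _ => by ring
    rw [hid]
    linarith
  have hC : 0 ≤ b₁ / a₁ - 1 := by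
    rw [sub_nonneg, one_le_div ha]
    exact hab
  rw [← tendsto_add_atTop_iff_nat 1]
  refine tendsto_zero_of_perturbed_descent
    (V := fun k => TnormSq (w (k + 1)) (v (k + 1) - vstar) (lam (k + 1) - lamstar))
    (U := fun k => TnormSq (w (k + 1)) (v (k + 2) - vstar) (lam (k + 2) - lamstar))
    (c := fun k => (b₁ / a₁ - 1) * (1 / ((k + 1 : ℕ) : ℝ) ^ 2))
    (fun k => TnormSq_nonneg (hpos _) _ _) (fun k => TnormSq_nonneg (hpos _) _ _)
    (fun k => TnormSq_nonneg (hpos _) _ _) (fun k => by positivity) ?_ (fun k => ?_)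
    (fun k => ?_)
  · exact ((summable_nat_add_iff 1).2
      (Real.summable_one_div_nat_pow.2 one_lt_two)).mul_left _
  · exact TnormSq_descent (hpos (k + 1)) (hlam' (k + 1)) (fun j => hF (k + 1) j vstar)
      (hG (k + 1) vstar) (hmono k)
      (by simpa only [hcons] using hsaddle (u (k + 2)) (v (k + 2)))
  · have hratio : ∀ x y : ℝ, a₁ ≤ x → y ≤ bEnd a₁ b₁ (k + 1) →
        y ≤ (1 + (b₁ / a₁ - 1) * (1 / ((k + 1 : ℕ) : ℝ) ^ 2)) * x := by
      intro x y hx hy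
      rw [bEnd_eq] at hy
      exact hy.trans (by gcongr)
    refine TnormSq_le_mul (fun j i => ?_) (fun j i => ?_) _ _
    · exact hratio _ _ (hw (k + 1) k.succ_pos j i).1
        ((hw (k + 2) (k + 1).succ_pos j i).2.trans (bEnd_succ_le ha hab k.succ_pos))
    · have h := hratio _ _ (hw (k + 2) (k + 1).succ_pos j i).1 (hw (k + 1) k.succ_pos j i).2
      rw [mul_one_div, div_le_div_iff₀ (hpos _ _ _) (hpos _ _ _), one_mul]
      exact h
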